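/- Let M ≥ 1 be an integer, m > 0, and fix U⁰ ∈ ℝ^M. Let R : ℝ^M × ℝ^M → ℝ^M be continuous with ‖R(x, g) − R(y, g)‖ ≤ m·‖x − y‖ for all x, y, g ∈ ℝ^M. Let K̃ ⊆ ℝ^M be compact, and let U^* : K̃ → ℝ^M be such that, defining U^0(g̃) := U⁰ and U^{l+1}(g̃) := U^l(g̃) + R(U^l(g̃), g̃), for every δ > 0 there exists L₀ such that ‖U^l(g̃) − U^*(g̃)‖ ≤ δ for all l > L₀ and all g̃ ∈ K̃. Then for every ε > 0 there exist an integer L ≥ 1, a positive integer d̂, matrices S ∈ ℝ^{M × d̂M}, B ∈ ℝ^{d̂M × 2M}, and a vector A ∈ ℝ^{d̂M}, such that the perturbed iterates V^0(g̃) := U⁰, V^{l+1}(g̃) := V^l(g̃) + S·ReLU(B·[V^l(g̃); g̃] + A) satisfy ‖V^L(g̃) − U^*(g̃)‖ ≤ ε for all g̃ ∈ K̃. -/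

import Mathlib

/-- The Euclidean norm on `ℝ^M` (vectors indexed by `Fin M`). -/
noncomputable def eNorm {M : ℕ} (v : Fin M → ℝ) : ℝ :=
  ‖(WithLp.equiv 2 (Fin M → ℝ)).symm v‖

/-- The rectified linear unit applied componentwise. -/
def relu {n : Type*} (z : n → ℝ) : n → ℝ := fun i => max (z i) 0

/-- The single ReLU neuron `x ↦ max (b ⬝ᵥ x + a) 0` as a continuous function on `X`. -/
noncomputable def reluNeuron {ι : Type*} [Fintype ι] (X : Set (ι → ℝ)) (b : ι → ℝ) (a : ℝ) :
    C(X, ℝ) where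
  toFun x := max (b ⬝ᵥ (x : ι → ℝ) + a) 0
  continuous_toFun := by fun_prop

/-- The exponential ridge function `x ↦ exp (b ⬝ᵥ x)` as a continuous function on `X`. -/
noncomputable def expRidge {ι : Type*} [Fintype ι] (X : Set (ι → ℝ)) (b : ι → ℝ) :
    C(X, ℝ) where
  toFun x := Real.exp (b ⬝ᵥ (x : ι → ℝ))
  continuous_toFun := by fun_prop

/-- The closed linear span of all ReLU neurons on `X`. -/
noncomputable def closedReluSpan {ι : Type*} [Fintype ι] (X : Set (ι → ℝ)) [CompactSpace X] :
    Submodule ℝ C(X, ℝ) :=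
  (Submodule.span ℝ (Set.range fun p : (ι → ℝ) × ℝ => reluNeuron X p.1 p.2)).topologicalClosure

lemma intervalIntegral_mem_of_isClosed {E : Type*} [NormedAddCommGroup E] [NormedSpace ℝ E]
    [CompleteSpace E] (W : Submodule ℝ E) (hW : IsClosed (W : Set E)) {F : ℝ → E}
    (hF : Continuous F) (hFW : ∀ s, F s ∈ W) (a b : ℝ) : ∫ s in a..b, F s ∈ W := by
  have : CompleteSpace W := hW.completeSpace_coe
  have h := W.subtypeL.intervalIntegral_comp_comm (a := a) (b := b)
    (f := fun s => (⟨F s, hFW s⟩ : W)) (μ := MeasureTheory.volume)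
    ((hF.subtype_mk hFW).intervalIntegrable a b)
  have h' : ∫ s in a..b, F s = W.subtypeL (∫ s in a..b, (⟨F s, hFW s⟩ : W)) := h
  rw [h']
  exact Subtype.property _

/-- Taylor's formula for `exp` with integral remainder written through the ReLU. -/
lemma integral_exp_mul_relu {T t : ℝ} (h₁ : -T ≤ t) (h₂ : t ≤ T) :
    ∫ s in (-T)..T, Real.exp s * max (t - s) 0 =
      Real.exp t - Real.exp (-T) * (t + T + 1) := by
  have hintegrable : ∀ a b : ℝ, IntervalIntegrable (fun s => Real.exp s * max (t - s) 0)
      MeasureTheory.volume a b := fun a b =>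
    Continuous.intervalIntegrable (by fun_prop) a b
  rw [← intervalIntegral.integral_add_adjacent_intervals (hintegrable (-T) t) (hintegrable t T)]
  have hleft : ∫ s in (-T)..t, Real.exp s * max (t - s) 0 =
      ∫ s in (-T)..t, Real.exp s * (t - s) := by
    refine intervalIntegral.integral_congr fun s hs => ?_
    rw [Set.uIcc_of_le h₁] at hs
    rw [max_eq_left (sub_nonneg.2 hs.2)]
  have hright : ∫ s in t..T, Real.exp s * max (t - s) 0 = 0 := by
    refine (intervalIntegral.integral_congr (g := fun _ => (0 : ℝ)) fun s hs => ?_).trans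
      intervalIntegral.integral_zero
    rw [Set.uIcc_of_le h₂] at hs
    rw [max_eq_right (sub_nonpos.2 hs.1), mul_zero]
  have hderiv : ∀ s ∈ Set.uIcc (-T) t,
      HasDerivAt (fun s => Real.exp s * (t - s + 1)) (Real.exp s * (t - s)) s := by
    intro s _
    have h := (Real.hasDerivAt_exp s).mul (((hasDerivAt_id s).const_sub t).add_const 1)
    refine h.congr_deriv ?_
    simp only [id]
    ring
  rw [hleft, hright, intervalIntegral.integral_eq_sub_of_hasDerivAt hderiv
    (Continuous.intervalIntegrable (by fun_prop) _ _)]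
  ring

section UniversalApproximation

variable {ι : Type*} [Fintype ι] {X : Set (ι → ℝ)} [CompactSpace X]

lemma reluNeuron_mem_closedReluSpan (b : ι → ℝ) (a : ℝ) :
    reluNeuron X b a ∈ closedReluSpan X :=
  Submodule.le_topologicalClosure _ (Submodule.subset_span ⟨(b, a), rfl⟩)

lemma expRidge_mem_closedReluSpan (b : ι → ℝ) : expRidge X b ∈ closedReluSpan X := by
  obtain ⟨T, hT⟩ : ∃ T : ℝ, ∀ x : X, |b ⬝ᵥ (x : ι → ℝ)| ≤ T := by
    let g : C(X, ℝ) := ⟨fun x => b ⬝ᵥ (x : ι → ℝ), by fun_prop⟩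
    exact ⟨‖g‖, fun x => g.norm_coe_le_norm x⟩
  let F : ℝ → C(X, ℝ) := fun s => Real.exp s • reluNeuron X b (-s)
  have hF : Continuous F := by
    refine Real.continuous_exp.smul (ContinuousMap.continuous_of_continuous_uncurry _ ?_)
    change Continuous fun p : ℝ × X => max (b ⬝ᵥ (p.2 : ι → ℝ) + -p.1) 0
    fun_prop
  have hInt : ∫ s in (-T)..T, F s ∈ closedReluSpan X :=
    intervalIntegral_mem_of_isClosed _ (Submodule.isClosed_topologicalClosure _) hF
      (fun s => Submodule.smul_mem _ _ (reluNeuron_mem_closedReluSpan b (-s))) _ _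
  have hAff : reluNeuron X b (T + 1) - reluNeuron X (-b) (-(T + 1)) ∈ closedReluSpan X :=
    Submodule.sub_mem _ (reluNeuron_mem_closedReluSpan _ _) (reluNeuron_mem_closedReluSpan _ _)
  have key : expRidge X b = (∫ s in (-T)..T, F s) +
      Real.exp (-T) • (reluNeuron X b (T + 1) - reluNeuron X (-b) (-(T + 1))) := by
    ext x
    have heval : (∫ s in (-T)..T, F s) x = ∫ s in (-T)..T, F s x :=
      ((ContinuousMap.evalCLM ℝ x).intervalIntegral_comp_comm
        (hF.intervalIntegrable (-T) T)).symm
    have hx := abs_le.1 (hT x)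
    have hFx : ∀ s, F s x = Real.exp s * max (b ⬝ᵥ (x : ι → ℝ) - s) 0 := fun s => rfl
    have hsplit : max (b ⬝ᵥ (x : ι → ℝ) + (T + 1)) 0 -
        max (-b ⬝ᵥ (x : ι → ℝ) + -(T + 1)) 0 = b ⬝ᵥ (x : ι → ℝ) + (T + 1) := by
      rw [neg_dotProduct, ← neg_add, max_comm _ (0 : ℝ), max_comm _ (0 : ℝ)]
      rw [max_eq_right (by linarith), max_eq_left (by linarith), sub_zero]
    simp only [ContinuousMap.add_apply, ContinuousMap.smul_apply, ContinuousMap.sub_apply,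
      heval, hFx, integral_exp_mul_relu hx.1 hx.2, smul_eq_mul]
    change Real.exp (b ⬝ᵥ (x : ι → ℝ)) = _ - _ + Real.exp (-T) *
      (max (b ⬝ᵥ (x : ι → ℝ) + (T + 1)) 0 - max (-b ⬝ᵥ (x : ι → ℝ) + -(T + 1)) 0)
    rw [hsplit]
    ring
  rw [key]
  exact Submodule.add_mem _ hInt (Submodule.smul_mem _ _ hAff)

variable (X) in
/-- Exponential ridge functions are closed under multiplication. -/
noncomputable def expRidgeSubmonoid : Submonoid C(X, ℝ) where
  carrier := Set.range (expRidge X)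
  mul_mem' := by
    rintro _ _ ⟨b, rfl⟩ ⟨c, rfl⟩
    refine ⟨b + c, ?_⟩
    ext x
    simp [expRidge, add_dotProduct, Real.exp_add]
  one_mem' := by
    refine ⟨0, ?_⟩
    ext x
    simp [expRidge]

variable (X) in
lemma closedReluSpan_eq_top : closedReluSpan X = ⊤ := by
  classical
  let S := Algebra.adjoin ℝ (expRidgeSubmonoid X : Set C(X, ℝ))
  have hsep : S.SeparatesPoints := by
    intro x y hxy
    obtain ⟨i, hi⟩ := Function.ne_iff.1 (Subtype.coe_injective.ne hxy)
    refine ⟨_, ⟨expRidge X (Pi.single i 1), Algebra.subset_adjoin ⟨_, rfl⟩, rfl⟩, ?_⟩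
    simpa [expRidge] using hi
  have hS : (Subalgebra.toSubmodule S) ≤ closedReluSpan X := by
    rw [Algebra.adjoin_eq_span, Submonoid.closure_eq, Submodule.span_le]
    rintro _ ⟨b, rfl⟩
    exact expRidge_mem_closedReluSpan b
  have htop := ContinuousMap.subalgebra_topologicalClosure_eq_top_of_separatesPoints S hsep
  rw [eq_top_iff]
  intro f _
  have hf : f ∈ closure (S : Set C(X, ℝ)) := by
    rw [← Subalgebra.topologicalClosure_coe, htop]
    trivial
  exact closure_minimal hS (Submodule.isClosed_topologicalClosure _) hf

end UniversalApproximation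

/-- Universal approximation: shallow ReLU networks approximate continuous functions uniformly on
compact sets. -/
lemma exists_shallow_relu_near {ι : Type*} [Fintype ι] {X : Set (ι → ℝ)} (hX : IsCompact X)
    {f : (ι → ℝ) → ℝ} (hf : Continuous f) {η : ℝ} (hη : 0 < η) :
    ∃ (n : ℕ) (c : Fin n → ℝ) (b : Fin n → ι → ℝ) (a : Fin n → ℝ), ∀ x ∈ X,
      |∑ k, c k * max (b k ⬝ᵥ x + a k) 0 - f x| < η := by
  have : CompactSpace X := isCompact_iff_compactSpace.1 hX
  let F : C(X, ℝ) := ⟨fun x => f x, by fun_prop⟩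
  have hF : F ∈ closure (Submodule.span ℝ
      (Set.range fun p : (ι → ℝ) × ℝ => reluNeuron X p.1 p.2) : Set C(X, ℝ)) := by
    rw [← Submodule.topologicalClosure_coe]
    change F ∈ closedReluSpan X
    rw [closedReluSpan_eq_top]
    trivial
  obtain ⟨N, hN, hdist⟩ := Metric.mem_closure_iff.1 hF η hη
  obtain ⟨n, c, g, rfl⟩ := Submodule.mem_span_set'.1 hN
  choose p hp using fun k => (g k).2
  refine ⟨n, c, fun k => (p k).1, fun k => (p k).2, fun x hx => ?_⟩
  have h := (ContinuousMap.dist_apply_le_dist (f := F) (g := ∑ k, c k • (g k : C(X, ℝ)))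
    ⟨x, hx⟩).trans_lt hdist
  rw [dist_comm, Real.dist_eq, ContinuousMap.sum_apply] at h
  simp only [ContinuousMap.smul_apply, ← hp] at h
  exact h

lemma eNorm_add_le {M : ℕ} (v w : Fin M → ℝ) : eNorm (v + w) ≤ eNorm v + eNorm w :=
  norm_add_le (WithLp.toLp 2 v) (WithLp.toLp 2 w)

lemma eNorm_zero {M : ℕ} : eNorm (0 : Fin M → ℝ) = 0 :=
  norm_zero (E := EuclideanSpace ℝ (Fin M))

lemma continuous_eNorm {M : ℕ} : Continuous (eNorm : (Fin M → ℝ) → ℝ) :=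
  (PiLp.continuous_toLp 2 _).norm

lemma isCompact_setOf_eNorm_le {M : ℕ} (C : ℝ) : IsCompact {v : Fin M → ℝ | eNorm v ≤ C} := by
  refine (isCompact_closedBall (0 : Fin M → ℝ) C).of_isClosed_subset
    (isClosed_le continuous_eNorm continuous_const) fun v hv => ?_
  rw [mem_closedBall_zero_iff]
  have h0 : 0 ≤ eNorm v := norm_nonneg _
  refine ((pi_norm_le_iff_of_nonneg h0).2 fun i => ?_).trans hv
  exact PiLp.norm_apply_le (WithLp.toLp 2 v) i

/-- Universal approximation for maps of a pair of vectors, with a number of neurons that is a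
positive multiple of `M`. -/
lemma exists_shallow_relu_network_near {M : ℕ} (hM : 1 ≤ M)
    {R : (Fin M → ℝ) → (Fin M → ℝ) → (Fin M → ℝ)}
    (hR : Continuous fun p : (Fin M → ℝ) × (Fin M → ℝ) => R p.1 p.2)
    {K₁ K₂ : Set (Fin M → ℝ)} (hK₁ : IsCompact K₁) (hK₂ : IsCompact K₂) {η : ℝ} (hη : 0 < η) :
    ∃ (d : ℕ), 0 < d ∧ ∃ (S : Matrix (Fin M) (Fin (d * M)) ℝ)
      (B : Matrix (Fin (d * M)) (Fin M ⊕ Fin M) ℝ) (A : Fin (d * M) → ℝ),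
      ∀ v ∈ K₁, ∀ g ∈ K₂,
        eNorm (S.mulVec (relu (B.mulVec (Sum.elim v g) + A)) - R v g) ≤ η := by
  obtain ⟨δ, hδ, hsmall⟩ : ∃ δ > 0, ∀ w : Fin M → ℝ, ‖w‖ < δ → eNorm w < η := by
    obtain ⟨δ, hδ, h⟩ := Metric.continuousAt_iff.1
      ((continuous_eNorm (M := M)).continuousAt (x := 0)) η hη
    refine ⟨δ, hδ, fun w hw => ?_⟩
    have := h (x := w) (by simpa using hw)
    rw [eNorm_zero, Real.dist_eq, sub_zero] at this
    exact (le_abs_self _).trans_lt this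
  have hX : IsCompact ((fun p : (Fin M → ℝ) × (Fin M → ℝ) => Sum.elim p.1 p.2) '' K₁ ×ˢ K₂) := by
    refine (hK₁.prod hK₂).image (continuous_pi fun j => ?_)
    cases j <;> simp only [Sum.elim_inl, Sum.elim_inr] <;> fun_prop
  have hRi : ∀ i, Continuous fun x : Fin M ⊕ Fin M → ℝ => R (x ∘ Sum.inl) (x ∘ Sum.inr) i := by
    intro i
    have hpair : Continuous fun x : Fin M ⊕ Fin M → ℝ => (x ∘ Sum.inl, x ∘ Sum.inr) :=
      (continuous_pi fun j => continuous_apply _).prodMk (continuous_pi fun j => continuous_apply _)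
    exact (continuous_apply i).comp (hR.comp hpair)
  choose n c b a h using fun i => exists_shallow_relu_near hX (hRi i) hδ
  let J := Option (Σ i, Fin (n i))
  let e : Fin (Fintype.card J * M) ≃ J × Fin M :=
    finProdFinEquiv.symm.trans ((Fintype.equivFin J).symm.prodCongr (Equiv.refl _))
  let c' : Fin M → J → ℝ := fun i => fun
    | none => 0
    | some ⟨j, k⟩ => if i = j then c j k else 0
  let b' : J → Fin M ⊕ Fin M → ℝ := fun
    | none => 0
    | some ⟨j, k⟩ => b j k
  let a' : J → ℝ := fun
    | none => 0
    | some ⟨j, k⟩ => a j k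
  refine ⟨Fintype.card J, Fintype.card_pos, fun i q => c' i (e q).1 / M, fun q => b' (e q).1,
    fun q => a' (e q).1, fun v hv g hg => (hsmall _ ?_).le⟩
  refine (pi_norm_lt_iff hδ).2 fun i => ?_
  have hi := h i _ ⟨(v, g), ⟨hv, hg⟩, rfl⟩
  have hM0 : (M : ℝ) ≠ 0 := by positivity
  rw [Real.norm_eq_abs]
  convert hi using 2
  change ∑ q, c' i (e q).1 / M * max (b' (e q).1 ⬝ᵥ Sum.elim v g + a' (e q).1) 0 -
    R v g i = _ - R v g i
  congr 1
  rw [e.sum_comp fun p : J × Fin M =>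
    c' i p.1 / M * max (b' p.1 ⬝ᵥ Sum.elim v g + a' p.1) 0]
  have hcollapse : ∀ j : J, ∑ _q : Fin M, c' i j / M * max (b' j ⬝ᵥ Sum.elim v g + a' j) 0 =
      c' i j * max (b' j ⬝ᵥ Sum.elim v g + a' j) 0 := by
    intro j
    rw [Finset.sum_const, Finset.card_univ, Fintype.card_fin, nsmul_eq_mul]
    field_simp
  simp only [Fintype.sum_prod_type, hcollapse, J, Fintype.sum_option, Fintype.sum_sigma]
  simp only [c', b', a', ite_mul, zero_mul, zero_add, Finset.sum_ite_irrel,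
    Finset.sum_const_zero, Finset.sum_ite_eq, Finset.mem_univ, if_true]

lemma exists_eNorm_iterate_le {M : ℕ} {U0 : Fin M → ℝ}
    {R : (Fin M → ℝ) → (Fin M → ℝ) → (Fin M → ℝ)}
    (hR : Continuous fun p : (Fin M → ℝ) × (Fin M → ℝ) => R p.1 p.2)
    {K : Set (Fin M → ℝ)} (hK : IsCompact K) (L : ℕ) :
    ∃ C : ℝ, ∀ l ≤ L, ∀ g ∈ K, eNorm ((fun x => x + R x g)^[l] U0) ≤ C := by
  have hcont : ∀ l, Continuous fun g => (fun x => x + R x g)^[l] U0 := by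
    intro l
    induction l with
    | zero => exact continuous_const
    | succ l ih =>
      simp only [Function.iterate_succ_apply']
      exact ih.add (hR.comp (ih.prodMk continuous_id))
  choose C hC using fun l =>
    hK.bddAbove_image (continuous_eNorm.comp (hcont l)).continuousOn
  refine ⟨∑ l ∈ Finset.range (L + 1), |C l|, fun l hl g hg => ?_⟩
  calc eNorm ((fun x => x + R x g)^[l] U0) ≤ C l := hC l ⟨g, hg, rfl⟩
    _ ≤ |C l| := le_abs_self _
    _ ≤ _ := Finset.single_le_sum (f := fun l => |C l|) (fun _ _ => abs_nonneg _)
      (Finset.mem_range.2 (Nat.lt_succ_of_le hl))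

/-- Discrete Grönwall estimate: if `P` is `η`-close to the `m`-Lipschitz map `Q` near the orbit of
`Q`, the perturbed orbit stays `η * (2 + m) ^ l`-close to the exact one. -/
lemma eNorm_iterate_sub_iterate_le {M : ℕ} {P Q : (Fin M → ℝ) → (Fin M → ℝ)} {m η C : ℝ}
    {U0 : Fin M → ℝ} {L : ℕ} (hm : 0 ≤ m) (hη : 0 ≤ η)
    (hlip : ∀ x y, eNorm (Q x - Q y) ≤ m * eNorm (x - y))
    (hC : ∀ l ≤ L, eNorm ((fun x => x + Q x)^[l] U0) ≤ C)
    (hPQ : ∀ v, eNorm v ≤ C + 1 → eNorm (P v - Q v) ≤ η)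
    (hηL : η * (2 + m) ^ L ≤ 1) :
    ∀ l ≤ L, eNorm ((fun x => x + P x)^[l] U0 - (fun x => x + Q x)^[l] U0) ≤
      η * (2 + m) ^ l := by
  intro l
  induction l with
  | zero => simpa [eNorm_zero] using hη
  | succ l ih =>
    intro hl
    have hle := ih (by omega)
    simp only [Function.iterate_succ_apply']
    set V := (fun x => x + P x)^[l] U0
    set U := (fun x => x + Q x)^[l] U0
    have hmono : η * (2 + m) ^ l ≤ η * (2 + m) ^ L :=
      mul_le_mul_of_nonneg_left (pow_le_pow_right₀ (by linarith) (by omega)) hη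
    have hV : eNorm V ≤ C + 1 := by
      have h := eNorm_add_le U (V - U)
      rw [add_sub_cancel] at h
      have := hC l (by omega)
      linarith
    have hone : η ≤ η * (2 + m) ^ l :=
      le_mul_of_one_le_right hη (one_le_pow₀ (by linarith))
    have hsplit : V + P V - (U + Q U) = (V - U) + ((Q V - Q U) + (P V - Q V)) := by abel
    rw [hsplit]
    calc _ ≤ eNorm (V - U) + (eNorm (Q V - Q U) + eNorm (P V - Q V)) :=
          (eNorm_add_le _ _).trans (by gcongr; exact eNorm_add_le _ _)
      _ ≤ eNorm (V - U) + (m * eNorm (V - U) + η) := by gcongr; exacts [hlip V U, hPQ V hV]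
      _ ≤ η * (2 + m) ^ l + (m * (η * (2 + m) ^ l) + η * (2 + m) ^ l) := by gcongr
      _ = η * (2 + m) ^ (l + 1) := by ring

/-- A convergent fixed-point iteration `U^{l+1} = U^l + R(U^l, g̃)` with a continuous,
`m`-Lipschitz (in its first argument) update map `R`, converging uniformly over a compact
set `K̃` of loadings to `U^*`, can be emulated to any accuracy `ε`, uniformly over `K̃`,
by iterating a single shallow ReLU network `(S, B, A)`:
`V^{l+1} = V^l + S·ReLU(B·[V^l; g̃] + A)`, starting from the same initial guess `U⁰`.
Inputs in `ℝ^{2M}` are indexed by `Fin M ⊕ Fin M`, with `[x; y] = Sum.elim x y`. -/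
theorem shallow_network_emulates_fixed_point_iteration
    (M : ℕ) (hM : 1 ≤ M) (m : ℝ) (hm : 0 < m)
    (U0 : Fin M → ℝ)
    (R : (Fin M → ℝ) → (Fin M → ℝ) → (Fin M → ℝ))
    (hRcont : Continuous (fun p : (Fin M → ℝ) × (Fin M → ℝ) => R p.1 p.2))
    (hRlip : ∀ x y g : Fin M → ℝ, eNorm (R x g - R y g) ≤ m * eNorm (x - y))
    (Kt : Set (Fin M → ℝ)) (hKt : IsCompact Kt)
    (Ustar : (Fin M → ℝ) → (Fin M → ℝ))
    (hConv : ∀ δ : ℝ, 0 < δ → ∃ L0 : ℕ, ∀ l : ℕ, l > L0 → ∀ gt ∈ Kt,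
      eNorm ((fun x => x + R x gt)^[l] U0 - Ustar gt) ≤ δ)
    (ε : ℝ) (hε : 0 < ε) :
    ∃ (L : ℕ), 1 ≤ L ∧
      ∃ (d : ℕ), 0 < d ∧
        ∃ (S : Matrix (Fin M) (Fin (d * M)) ℝ)
          (B : Matrix (Fin (d * M)) (Fin M ⊕ Fin M) ℝ)
          (A : Fin (d * M) → ℝ),
          ∀ gt ∈ Kt,
            eNorm
              ((fun v : Fin M → ℝ =>
                  v + S.mulVec (relu (B.mulVec (Sum.elim v gt) + A)))^[L] U0
                - Ustar gt) ≤ ε := by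
  obtain ⟨L0, hL0⟩ := hConv (ε / 2) (by positivity)
  obtain ⟨C, hC⟩ := exists_eNorm_iterate_le (U0 := U0) hRcont hKt (L0 + 1)
  set η : ℝ := min 1 (ε / 2) / (2 + m) ^ (L0 + 1)
  have hη : 0 < η := by positivity
  have hηL : η * (2 + m) ^ (L0 + 1) = min 1 (ε / 2) := div_mul_cancel₀ _ (by positivity)
  obtain ⟨d, hd, S, B, A, hSBA⟩ :=
    exists_shallow_relu_network_near hM hRcont (isCompact_setOf_eNorm_le (C + 1)) hKt hη
  refine ⟨L0 + 1, by omega, d, hd, S, B, A, fun gt hgt => ?_⟩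
  have hclose := eNorm_iterate_sub_iterate_le
    (P := fun v => S.mulVec (relu (B.mulVec (Sum.elim v gt) + A))) (Q := fun v => R v gt)
    hm.le hη.le (fun x y => hRlip x y gt) (fun l hl => hC l hl gt hgt)
    (fun v hv => hSBA v hv gt hgt) (hηL.le.trans (min_le_left _ _)) (L0 + 1) le_rfl
  have hlim := hL0 (L0 + 1) (Nat.lt_succ_self _) gt hgt
  have htri := eNorm_add_le
    ((fun v => v + S.mulVec (relu (B.mulVec (Sum.elim v gt) + A)))^[L0 + 1] U0 -
      (fun x => x + R x gt)^[L0 + 1] U0)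
    ((fun x => x + R x gt)^[L0 + 1] U0 - Ustar gt)
  rw [sub_add_sub_cancel] at htri
  have hmin := min_le_right 1 (ε / 2)
  linarith
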